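/- For every integer n ≥ 6, there exists a gross substitutes valuation v on [n] that is irreducible under merging and does not belong to the smallest class of valuations on subsets of [n] that contains all weighted matroid rank valuations of matroids on subsets of [n] and all partition valuations on subsets of [n], and is closed under merging and endowment. -/

import Mathlib

open Finset

variable {α : Type*} [DecidableEq α]

/-- A valuation on ground set `E`: zero at the empty set, non-negative,
and monotone on subsets of `E`. -/
def IsValuation (E : Finset α) (u : Finset α → ℝ) : Prop :=
  u ∅ = 0 ∧ (∀ S : Finset α, S ⊆ E → 0 ≤ u S) ∧
    ∀ ⦃S T : Finset α⦄, S ⊆ T → T ⊆ E → u S ≤ u T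

/-- Gross substitutes valuation on ground set `E`: a valuation satisfying the
M♮-exchange property. -/
def GrossSubstitutes (E : Finset α) (u : Finset α → ℝ) : Prop :=
  IsValuation E u ∧
    ∀ ⦃S T : Finset α⦄, S ⊆ E → T ⊆ E → ∀ i ∈ S \ T,
      u S + u T ≤ u (S.erase i) + u (insert i T) ∨
        ∃ j ∈ T \ S,
          u S + u T ≤ u (insert j (S.erase i)) + u ((insert i T).erase j)

/-- The merge (convolution) of a valuation `u1` on `E1` and `u2` on `E2`:
`(u1 * u2)(S) = max { u1 S1 + u2 S2 : S = S1 ∪ S2, S1 ∩ S2 = ∅, S1 ⊆ E1, S2 ⊆ E2 }`. -/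
noncomputable def mergeVal (E1 E2 : Finset α) (u1 u2 : Finset α → ℝ)
    (S : Finset α) : ℝ :=
  sSup {x : ℝ | ∃ S1 S2 : Finset α, S = S1 ∪ S2 ∧ Disjoint S1 S2 ∧
    S1 ⊆ E1 ∧ S2 ⊆ E2 ∧ x = u1 S1 + u2 S2}

/-- A (finite) matroid with ground set `E`, given by its independent sets. -/
structure FinMatroid (α : Type*) [DecidableEq α] where
  E : Finset α
  Indep : Finset α → Prop
  indep_empty : Indep ∅
  indep_subset : ∀ ⦃I J : Finset α⦄, Indep J → I ⊆ J → Indep I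
  indep_aug : ∀ ⦃I J : Finset α⦄, Indep I → Indep J → I.card < J.card →
    ∃ e ∈ J, e ∉ I ∧ Indep (insert e I)
  subset_ground : ∀ ⦃I : Finset α⦄, Indep I → I ⊆ E

/-- The weighted matroid rank valuation:
`ρ^w(T) = max { ∑_{i ∈ I} w i : I independent, I ⊆ T }`. -/
noncomputable def weightedRank (M : FinMatroid α) (w : α → ℝ) (T : Finset α) : ℝ :=
  sSup {x : ℝ | ∃ I : Finset α, M.Indep I ∧ I ⊆ T ∧ x = ∑ i ∈ I, w i}

/-- `M` is the matroid union of `M1` and `M2`. -/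
def IsMatroidUnion (M M1 M2 : FinMatroid α) : Prop :=
  M.E = M1.E ∪ M2.E ∧
    ∀ I : Finset α, M.Indep I ↔
      ∃ I1 I2 : Finset α, M1.Indep I1 ∧ M2.Indep I2 ∧ I = I1 ∪ I2

/-- A matroid is irreducible under matroid union if whenever it is a union of
two matroids, one of them equals the matroid itself. -/
def MatroidIrreducible (M : FinMatroid α) : Prop :=
  ∀ M1 M2 : FinMatroid α, IsMatroidUnion M M1 M2 → M1 = M ∨ M2 = M

/-- A valuation with ground set the full set `[n]` is irreducible under merging
if whenever it is the merge of two gross substitutes valuations whose ground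
sets cover `[n]`, it equals one of them. -/
def IrreducibleVal [Fintype α] (v : Finset α → ℝ) : Prop :=
  ∀ (E1 E2 : Finset α) (u1 u2 : Finset α → ℝ),
    GrossSubstitutes E1 u1 → GrossSubstitutes E2 u2 → E1 ∪ E2 = Finset.univ →
    v = mergeVal E1 E2 u1 u2 → v = u1 ∨ v = u2

/-- The partition valuation `v^{π,a,b}`: value `0` at `∅`, value `a` on nonempty
sets contained in a single part of `π`, and value `b` otherwise. -/
noncomputable def partitionVal {E : Finset α} (π : Finpartition E) (a b : ℝ)
    (I : Finset α) : ℝ :=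
  if I = ∅ then 0 else if ∃ p ∈ π.parts, I ⊆ p then a else b

/-- `MBVP n` : the smallest class of valuations on subsets of `[n]` containing
all weighted matroid rank valuations and all partition valuations on subsets
of `[n]`, closed under merging and endowment. -/
inductive MBVP (n : ℕ) : Finset (Fin n) → (Finset (Fin n) → ℝ) → Prop
  | wrank (M : FinMatroid (Fin n)) (w : Fin n → ℝ) (hw : ∀ i, 0 ≤ w i) :
      MBVP n M.E (weightedRank M w)
  | part (E : Finset (Fin n)) (π : Finpartition E) (a b : ℝ)
      (ha : 0 < a) (hab : a < b) (hb : b < 2 * a) :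
      MBVP n E (partitionVal π a b)
  | merge {E1 E2 : Finset (Fin n)} {u1 u2 : Finset (Fin n) → ℝ} :
      MBVP n E1 u1 → MBVP n E2 u2 → MBVP n (E1 ∪ E2) (mergeVal E1 E2 u1 u2)
  | endow {E : Finset (Fin n)} {u : Finset (Fin n) → ℝ} (T : Finset (Fin n))
      (hT : T ⊆ E) : MBVP n E u → MBVP n (E \ T) (fun S => u (S ∪ T) - u T)

theorem GrossSubstitutes.congr {E : Finset α} {u u' : Finset α → ℝ} (hu : GrossSubstitutes E u)
    (h : ∀ S ⊆ E, u' S = u S) : GrossSubstitutes E u' := by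
  obtain ⟨⟨h0, hpos, hmono⟩, hex⟩ := hu
  refine ⟨⟨by rw [h _ (empty_subset _), h0], fun S hS => by rw [h _ hS]; exact hpos S hS,
    fun S T hST hT => by rw [h _ hT, h _ (hST.trans hT)]; exact hmono hST hT⟩, ?_⟩
  intro S T hS hT i hi
  have hiS := mem_sdiff.1 hi
  have hS1 : S.erase i ⊆ E := (erase_subset _ _).trans hS
  have hT1 : insert i T ⊆ E := insert_subset (hS hiS.1) hT
  rcases hex hS hT i hi with h1 | ⟨j, hj, h1⟩
  · left
    rwa [h _ hS, h _ hT, h _ hS1, h _ hT1]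
  · refine Or.inr ⟨j, hj, ?_⟩
    rwa [h _ hS, h _ hT, h _ (insert_subset (hT (mem_sdiff.1 hj).1) hS1),
      h _ ((erase_subset _ _).trans hT1)]

/-- Replacing elements by parallel copies preserves gross substitutes. -/
theorem GrossSubstitutes.comp_image {β : Type*} [DecidableEq β] (c : α → β) {E : Finset α}
    {g : Finset β → ℝ} (hg : GrossSubstitutes (E.image c) g) :
    GrossSubstitutes E (fun S => g (S.image c)) := by
  obtain ⟨⟨h0, hpos, hmono⟩, hex⟩ := hg
  refine ⟨⟨by simpa using h0, fun S hS => hpos _ (image_subset_image hS),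
    fun S T hST hT => hmono (image_subset_image hST) (image_subset_image hT)⟩, ?_⟩
  intro S T hS hT i hi
  obtain ⟨hiS, hiT⟩ := mem_sdiff.1 hi
  have hT1 : insert i T ⊆ E := insert_subset (hS hiS) hT
  dsimp only
  by_cases hdup : c i ∈ (S.erase i).image c
  · left
    have e1 : (S.erase i).image c = S.image c := by
      ext x; simp only [mem_image, mem_erase] at *; grind
    rw [e1]
    have := hmono (image_subset_image (f := c) (subset_insert i T)) (image_subset_image hT1)
    linarith
  have e1 : (S.erase i).image c = (S.image c).erase (c i) := by
    ext x; simp only [mem_image, mem_erase] at *; grind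
  by_cases hp : c i ∈ T.image c
  · obtain ⟨j, hjT, hj⟩ := mem_image.1 hp
    have hjS : j ∉ S := fun h => hdup (mem_image.2 ⟨j, by grind, hj⟩)
    refine Or.inr ⟨j, mem_sdiff.2 ⟨hjT, hjS⟩, ?_⟩
    have e2 : (insert j (S.erase i)).image c = S.image c := by
      ext x; simp only [mem_image, mem_erase, mem_insert] at *; grind
    have e3 : ((insert i T).erase j).image c = T.image c := by
      ext x; simp only [mem_image, mem_erase, mem_insert] at *; grind
    rw [e2, e3]
  have hiI : c i ∈ S.image c \ T.image c := mem_sdiff.2 ⟨mem_image_of_mem _ hiS, hp⟩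
  rcases hex (image_subset_image hS) (image_subset_image hT) _ hiI with h1 | ⟨q, hq, h1⟩
  · left
    rwa [e1, image_insert]
  · obtain ⟨hqT, hqS⟩ := mem_sdiff.1 hq
    obtain ⟨j, hjT, rfl⟩ := mem_image.1 hqT
    have hjS : j ∉ S := fun h => hqS (mem_image_of_mem _ h)
    refine Or.inr ⟨j, mem_sdiff.2 ⟨hjT, hjS⟩, ?_⟩
    rw [image_insert, e1]
    refine h1.trans (add_le_add le_rfl (hmono ?_ (image_subset_image
      ((erase_subset _ _).trans hT1))))
    intro x
    simp only [mem_image, mem_erase, mem_insert]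
    grind

/-- Identification of two elements `a` and `b`, keeping the name `a`. -/
noncomputable def identify (a b : α) (f : Finset α → ℝ) (X : Finset α) : ℝ :=
  if a ∈ X then max (f X) (f (insert b (X.erase a))) else f X

theorem le_identify (a b : α) (f : Finset α → ℝ) (X : Finset α) : f X ≤ identify a b f X := by
  unfold identify; split_ifs <;> simp

theorem le_identify_swap {a : α} (b : α) (f : Finset α → ℝ) {X : Finset α} (ha : a ∈ X) :
    f (insert b (X.erase a)) ≤ identify a b f X := by
  unfold identify; rw [if_pos ha]; exact le_max_right _ _

theorem identify_exchange_same {a b : α} {E : Finset α} {f : Finset α → ℝ}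
    (hf : GrossSubstitutes E f) {X Y : Finset α} (hX : X ⊆ E) (hY : Y ⊆ E)
    {i : α} (hi : i ∈ X \ Y) :
    f X + f Y ≤ identify a b f (X.erase i) + identify a b f (insert i Y) ∨
      ∃ j ∈ Y \ X, f X + f Y ≤
        identify a b f (insert j (X.erase i)) + identify a b f ((insert i Y).erase j) := by
  rcases hf.2 hX hY i hi with h | ⟨j, hj, h⟩
  · exact Or.inl (h.trans (add_le_add (le_identify _ _ _ _) (le_identify _ _ _ _)))
  · exact Or.inr ⟨j, hj, h.trans (add_le_add (le_identify _ _ _ _) (le_identify _ _ _ _))⟩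

theorem identify_exchange_mixed {a b : α} (hab : a ≠ b) {E : Finset α} {f : Finset α → ℝ}
    (hf : GrossSubstitutes E f) (hb : b ∈ E) {X Y : Finset α}
    (hX : X ⊆ E.erase b) (hY : Y ⊆ E.erase b) {i : α} (hi : i ∈ X \ Y)
    (haX : a ∈ X) (haY : a ∈ Y)
    (hlt : f (insert b (X.erase a)) + f Y < f X + f (insert b (Y.erase a))) :
    f X + f (insert b (Y.erase a)) ≤
        identify a b f (X.erase i) + identify a b f (insert i Y) ∨
      ∃ j ∈ Y \ X, f X + f (insert b (Y.erase a)) ≤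
        identify a b f (insert j (X.erase i)) + identify a b f ((insert i Y).erase j) := by
  obtain ⟨hiX, hiY⟩ := mem_sdiff.1 hi
  have hbX : b ∉ X := fun h => by simpa using hX h
  have hbY : b ∉ Y := fun h => by simpa using hY h
  have hia : i ≠ a := by rintro rfl; exact hiY haY
  have hib : i ≠ b := by rintro rfl; exact hbX hiX
  have hXE : X ⊆ E := hX.trans (erase_subset _ _)
  have hYE : Y ⊆ E := hY.trans (erase_subset _ _)
  have hYbE : insert b (Y.erase a) ⊆ E := insert_subset hb ((erase_subset _ _).trans hYE)
  have hins : insert i (insert b (Y.erase a)) = insert b ((insert i Y).erase a) := by grind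
  have hne : f X + f (insert b (Y.erase a)) ≤
      f (insert b (X.erase i)) + f (insert i (Y.erase a)) →
      f X + f (insert b (Y.erase a)) ≤
        identify a b f (X.erase i) + identify a b f (insert i Y) ∨
      ∃ j ∈ Y \ X, f X + f (insert b (Y.erase a)) ≤
        identify a b f (insert j (X.erase i)) + identify a b f ((insert i Y).erase j) := by
    intro h
    have hUE : insert b (X.erase i) ⊆ E := insert_subset hb ((erase_subset _ _).trans hXE)
    have hVE : insert i (Y.erase a) ⊆ E :=
      insert_subset (hXE hiX) ((erase_subset _ _).trans hYE)
    rcases hf.2 hUE hVE a (by grind) with h2 | ⟨j, hj, h2⟩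
    · left
      have e1 : (insert b (X.erase i)).erase a = insert b ((X.erase i).erase a) := by grind
      have e2 : insert a (insert i (Y.erase a)) = insert i Y := by grind
      rw [e1, e2] at h2
      have := le_identify_swap b f (show a ∈ X.erase i by grind)
      have := le_identify a b f (insert i Y)
      linarith
    · by_cases hji : j = i
      · subst hji
        have e1 : insert j ((insert b (X.erase j)).erase a) = insert b (X.erase a) := by grind
        have e2 : (insert a (insert j (Y.erase a))).erase j = Y := by grind
        rw [e1, e2] at h2
        linarith
      · refine Or.inr ⟨j, by grind, ?_⟩
        have e1 : insert j ((insert b (X.erase i)).erase a) =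
          insert b ((insert j (X.erase i)).erase a) := by grind
        have e2 : (insert a (insert i (Y.erase a))).erase j = (insert i Y).erase j := by grind
        rw [e1, e2] at h2
        have := le_identify_swap b f (show a ∈ insert j (X.erase i) by grind)
        have := le_identify a b f ((insert i Y).erase j)
        linarith
  rcases hf.2 hXE hYbE i (by grind) with h | ⟨j, hj, h⟩
  · left
    rw [hins] at h
    have := le_identify_swap b f (show a ∈ insert i Y by grind)
    have := le_identify a b f (X.erase i)
    linarith
  · by_cases hjb : j = b
    · subst hjb
      apply hne
      have e1 : (insert i (insert j (Y.erase a))).erase j = insert i (Y.erase a) := by grind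
      rwa [e1] at h
    · refine Or.inr ⟨j, by grind, ?_⟩
      have e1 : (insert i (insert b (Y.erase a))).erase j =
        insert b (((insert i Y).erase j).erase a) := by grind
      rw [e1] at h
      have := le_identify_swap b f (show a ∈ (insert i Y).erase j by grind)
      have := le_identify a b f (insert j (X.erase i))
      linarith

theorem GrossSubstitutes.comp_swap {a b : α} {E : Finset α} {f : Finset α → ℝ}
    (hf : GrossSubstitutes E f) (ha : a ∈ E) (hb : b ∈ E) :
    GrossSubstitutes E (fun S => f (S.image (Equiv.swap a b))) := by
  refine GrossSubstitutes.comp_image (Equiv.swap a b) ?_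
  have : E.image (Equiv.swap a b) = E := by
    apply eq_of_subset_of_card_le
    · intro x hx
      obtain ⟨y, hy, rfl⟩ := mem_image.1 hx
      rw [Equiv.swap_apply_def]
      split_ifs <;> assumption
    · rw [card_image_of_injective _ (Equiv.injective _)]
  rwa [this]

theorem image_swap_of_mem {a b : α} {X : Finset α} (ha : a ∈ X) (hb : b ∉ X) :
    X.image (Equiv.swap a b) = insert b (X.erase a) := by
  ext x
  simp only [mem_image, Equiv.swap_apply_def]
  grind

theorem image_swap_of_notMem {a b : α} {X : Finset α} (ha : a ∉ X) (hb : b ∉ X) :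
    X.image (Equiv.swap a b) = X := by
  ext x
  simp only [mem_image, Equiv.swap_apply_def]
  grind

theorem image_swap_image_swap (a b : α) (X : Finset α) :
    (X.image (Equiv.swap a b)).image (Equiv.swap a b) = X := by
  rw [image_image, ← Equiv.coe_trans, Equiv.swap_swap, Equiv.coe_refl, image_id]

theorem identify_comp_swap {a b : α} (f : Finset α → ℝ) {X : Finset α} (hb : b ∉ X) :
    identify a b (fun S => f (S.image (Equiv.swap a b))) X = identify a b f X := by
  unfold identify
  by_cases ha : a ∈ X
  · have e : (insert b (X.erase a)).image (Equiv.swap a b) = X := by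
      rw [← image_swap_of_mem ha hb, image_swap_image_swap]
    simp only [if_pos ha, e, image_swap_of_mem ha hb]
    exact max_comm _ _
  · simp only [if_neg ha, image_swap_of_notMem ha hb]

theorem GrossSubstitutes.identify_pair {a b : α} (hab : a ≠ b) {E : Finset α} {f : Finset α → ℝ}
    (hf : GrossSubstitutes E f) (ha : a ∈ E) (hb : b ∈ E) :
    GrossSubstitutes (E.erase b) (identify a b f) := by
  have hsub : E.erase b ⊆ E := erase_subset _ _
  refine ⟨⟨by simp [identify, hf.1.1], fun S hS =>
    (hf.1.2.1 S (hS.trans hsub)).trans (le_identify _ _ _ _), fun S T hST hT => ?_⟩, ?_⟩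
  · have h1 := (hf.1.2.2 hST (hT.trans hsub)).trans (le_identify a b f T)
    by_cases haS : a ∈ S
    · rw [identify, if_pos haS]
      refine max_le h1 ((hf.1.2.2 (insert_subset_insert _ (erase_subset_erase _ hST))
        (insert_subset hb ((erase_subset _ _).trans (hT.trans hsub)))).trans
          (le_identify_swap b f (hST haS)))
    · rwa [identify, if_neg haS]
  · intro X Y hX hY i hi
    obtain ⟨hiX, hiY⟩ := mem_sdiff.1 hi
    have hbX : b ∉ X := fun h => by simpa using hX h
    have hbY : b ∉ Y := fun h => by simpa using hY h
    have hXE := hX.trans hsub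
    have hYE := hY.trans hsub
    have hf' := hf.comp_swap ha hb
    set f' : Finset α → ℝ := fun S => f (S.image (Equiv.swap a b)) with hf'def
    have hid : ∀ Z : Finset α, b ∉ Z → identify a b f' Z = identify a b f Z :=
      fun Z hZ => identify_comp_swap f hZ
    have hf'X : a ∈ X → f' X = f (insert b (X.erase a)) := fun h => by
      rw [hf'def]; dsimp only; rw [image_swap_of_mem h hbX]
    have hf'Y : a ∈ Y → f' Y = f (insert b (Y.erase a)) := fun h => by
      rw [hf'def]; dsimp only; rw [image_swap_of_mem h hbY]
    have hf'X' : a ∉ X → f' X = f X := fun h => by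
      rw [hf'def]; dsimp only; rw [image_swap_of_notMem h hbX]
    have hf'Y' : a ∉ Y → f' Y = f Y := fun h => by
      rw [hf'def]; dsimp only; rw [image_swap_of_notMem h hbY]
    have transfer : ∀ c : ℝ, (c ≤ identify a b f' (X.erase i) +
          identify a b f' (insert i Y) ∨ ∃ j ∈ Y \ X, c ≤
        identify a b f' (insert j (X.erase i)) +
          identify a b f' ((insert i Y).erase j)) →
        (c ≤ identify a b f (X.erase i) + identify a b f (insert i Y) ∨
          ∃ j ∈ Y \ X, c ≤ identify a b f (insert j (X.erase i)) +
          identify a b f ((insert i Y).erase j)) := by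
      rintro c (h | ⟨j, hj, h⟩)
      · left
        rwa [hid _ (by grind), hid _ (by grind)] at h
      · refine Or.inr ⟨j, hj, ?_⟩
        rwa [hid _ (by grind), hid _ (by grind)] at h
    have hXc : identify a b f X = max (f X) (f' X) := by
      unfold identify; split_ifs with h
      · rw [hf'X h]
      · rw [hf'X' h, max_self]
    have hYc : identify a b f Y = max (f Y) (f' Y) := by
      unfold identify; split_ifs with h
      · rw [hf'Y h]
      · rw [hf'Y' h, max_self]
    rw [hXc, hYc]
    rcases le_total (f' X) (f X) with h1 | h1 <;> rcases le_total (f' Y) (f Y) with h2 | h2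
    · rw [max_eq_left h1, max_eq_left h2]
      exact identify_exchange_same hf hXE hYE hi
    · rw [max_eq_left h1, max_eq_right h2]
      rcases h1.eq_or_lt with h3 | h3
      · rw [← h3]
        exact transfer _ (identify_exchange_same hf' hXE hYE hi)
      rcases h2.eq_or_lt with h4 | h4
      · rw [← h4]
        exact identify_exchange_same hf hXE hYE hi
      have haX : a ∈ X := by by_contra h; exact h3.ne (hf'X' h)
      have haY : a ∈ Y := by by_contra h; exact h4.ne' (hf'Y' h)
      rw [hf'Y haY]
      refine identify_exchange_mixed hab hf hb hX hY hi haX haY ?_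
      rw [← hf'X haX, ← hf'Y haY]
      linarith
    · rw [max_eq_right h1, max_eq_left h2]
      rcases h1.eq_or_lt with h3 | h3
      · rw [← h3]
        exact identify_exchange_same hf hXE hYE hi
      rcases h2.eq_or_lt with h4 | h4
      · rw [← h4]
        exact transfer _ (identify_exchange_same hf' hXE hYE hi)
      have haX : a ∈ X := by by_contra h; exact h3.ne' (hf'X' h)
      have haY : a ∈ Y := by by_contra h; exact h4.ne (hf'Y' h)
      have eX : f' (insert b (X.erase a)) = f X := by
        rw [hf'def]; dsimp only; rw [← image_swap_of_mem haX hbX, image_swap_image_swap]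
      have eY : f' (insert b (Y.erase a)) = f Y := by
        rw [hf'def]; dsimp only; rw [← image_swap_of_mem haY hbY, image_swap_image_swap]
      apply transfer
      rw [← eY]
      refine identify_exchange_mixed hab hf' hb hX hY hi haX haY ?_
      rw [eX, eY]
      linarith
    · rw [max_eq_right h1, max_eq_right h2]
      exact transfer _ (identify_exchange_same hf' hXE hYE hi)

theorem GrossSubstitutes.directSum {E1 E2 : Finset α} {u1 u2 : Finset α → ℝ}
    (h1 : GrossSubstitutes E1 u1) (h2 : GrossSubstitutes E2 u2) :
    GrossSubstitutes (E1.disjSum E2) (fun X : Finset (α ⊕ α) => u1 X.toLeft + u2 X.toRight) := by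
  refine ⟨⟨?_, fun S hS => ?_, fun S T hST hT => ?_⟩, ?_⟩
  · have e1 : (∅ : Finset (α ⊕ α)).toLeft = ∅ := by ext; simp
    have e2 : (∅ : Finset (α ⊕ α)).toRight = ∅ := by ext; simp
    simp only [e1, e2, h1.1.1, h2.1.1, add_zero]
  · rw [subset_disjSum] at hS
    exact add_nonneg (h1.1.2.1 _ hS.1) (h2.1.2.1 _ hS.2)
  · rw [subset_disjSum] at hT
    exact add_le_add (h1.1.2.2 (toLeft_subset_toLeft hST) hT.1)
      (h2.1.2.2 (toRight_subset_toRight hST) hT.2)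
  · intro S T hS hT i hi
    rw [subset_disjSum] at hS hT
    have eraseLL : ∀ (X : Finset (α ⊕ α)) a, (X.erase (Sum.inl a)).toLeft = X.toLeft.erase a :=
      fun X a => by ext; simp
    have eraseLR : ∀ (X : Finset (α ⊕ α)) a, (X.erase (Sum.inl a)).toRight = X.toRight :=
      fun X a => by ext; simp
    have eraseRR : ∀ (X : Finset (α ⊕ α)) a, (X.erase (Sum.inr a)).toRight = X.toRight.erase a :=
      fun X a => by ext; simp
    have eraseRL : ∀ (X : Finset (α ⊕ α)) a, (X.erase (Sum.inr a)).toLeft = X.toLeft :=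
      fun X a => by ext; simp
    rcases i with i | i
    · rcases h1.2 hS.1 hT.1 i (by simpa using hi) with h | ⟨j, hj, h⟩
      · left
        simp only [eraseLL, eraseLR, toLeft_insert_inl, toRight_insert_inl]
        linarith
      · refine Or.inr ⟨Sum.inl j, by simpa using hj, ?_⟩
        simp only [eraseLL, eraseLR, toLeft_insert_inl, toRight_insert_inl]
        linarith
    · rcases h2.2 hS.2 hT.2 i (by simpa using hi) with h | ⟨j, hj, h⟩
      · left
        simp only [eraseRL, eraseRR, toLeft_insert_inr, toRight_insert_inr]
        linarith
      · refine Or.inr ⟨Sum.inr j, by simpa using hj, ?_⟩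
        simp only [eraseRL, eraseRR, toLeft_insert_inr, toRight_insert_inr]
        linarith

/-- The direct sum of two valuations with the two copies of each element of `D` identified. -/
theorem exists_partialMerge {E1 E2 : Finset α} {u1 u2 : Finset α → ℝ}
    (h1 : GrossSubstitutes E1 u1) (h2 : GrossSubstitutes E2 u2) (D : Finset α)
    (hD : D ⊆ E1 ∩ E2) :
    ∃ h : Finset (α ⊕ α) → ℝ, GrossSubstitutes (E1.disjSum (E2 \ D)) h ∧
      ∀ X : Finset (α ⊕ α),
        (∃ K ⊆ D ∩ X.toLeft, h X = u1 (X.toLeft \ K) + u2 (X.toRight ∪ K)) ∧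
        ∀ K ⊆ D ∩ X.toLeft, u1 (X.toLeft \ K) + u2 (X.toRight ∪ K) ≤ h X := by
  induction D using Finset.induction_on with
  | empty =>
    refine ⟨_, by simpa using h1.directSum h2, fun X => ⟨⟨∅, by simp, by simp⟩, ?_⟩⟩
    intro K hK
    have : K = ∅ := by simpa using hK
    simp [this]
  | insert d D hd ih =>
    obtain ⟨h, hgs, hX⟩ := ih ((subset_insert _ _).trans hD)
    have hdE := mem_inter.1 (hD (mem_insert_self d D))
    refine ⟨identify (Sum.inl d) (Sum.inr d) h, ?_, fun X => ?_⟩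
    · have e : E1.disjSum (E2 \ insert d D) = (E1.disjSum (E2 \ D)).erase (Sum.inr d) := by
        ext x
        rcases x with x | x
        · simp
        · simp only [inr_mem_disjSum, mem_sdiff, mem_insert, mem_erase, ne_eq, Sum.inr.injEq]
          tauto
      rw [e]
      exact hgs.identify_pair (by simp) (by simpa using hdE.1)
        (by simpa using ⟨hdE.2, hd⟩)
    · have eL : (insert (Sum.inr d) (X.erase (Sum.inl d))).toLeft = X.toLeft.erase d := by
        ext; simp
      have eR : (insert (Sum.inr d) (X.erase (Sum.inl d))).toRight = insert d X.toRight := by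
        ext; simp
      obtain ⟨⟨K, hK, hKe⟩, hle⟩ := hX X
      obtain ⟨⟨K', hK', hKe'⟩, hle'⟩ := hX (insert (Sum.inr d) (X.erase (Sum.inl d)))
      rw [eL] at hK' hle'
      rw [eL, eR] at hKe'
      rw [eR] at hle'
      refine ⟨?_, fun L hL => ?_⟩
      · have hfirst : ∃ K ⊆ insert d D ∩ X.toLeft,
            h X = u1 (X.toLeft \ K) + u2 (X.toRight ∪ K) :=
          ⟨K, hK.trans (inter_subset_inter_right (subset_insert _ _)), hKe⟩
        unfold identify
        split_ifs with hmem
        · rcases max_choice (h X) (h (insert (Sum.inr d) (X.erase (Sum.inl d)))) with hm | hm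
          · rw [hm]; exact hfirst
          · rw [hm, hKe']
            refine ⟨insert d K', ?_, ?_⟩
            · have := mem_toLeft.2 hmem
              grind
            · congr 2
              · ext; simp only [mem_sdiff, mem_erase, mem_insert]; tauto
              · ext; simp only [mem_union, mem_insert]; tauto
        · exact hfirst
      · by_cases hdL : d ∈ L
        · have hmem : Sum.inl d ∈ X := mem_toLeft.1 (mem_inter.1 (hL hdL)).2
          refine le_trans ?_ (le_identify_swap _ h hmem)
          have := hle' (L.erase d) (by grind)
          have e1 : X.toLeft.erase d \ L.erase d = X.toLeft \ L := by grind
          have e2 : insert d X.toRight ∪ L.erase d = X.toRight ∪ L := by grind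
          rwa [e1, e2] at this
        · exact (hle L (by grind)).trans (le_identify _ _ _ _)

theorem mergeVal_isGreatest {E1 E2 : Finset α} (u1 u2 : Finset α → ℝ) {S : Finset α}
    (hS : S ⊆ E1 ∪ E2) :
    IsGreatest {x : ℝ | ∃ S1 S2 : Finset α, S = S1 ∪ S2 ∧ Disjoint S1 S2 ∧
      S1 ⊆ E1 ∧ S2 ⊆ E2 ∧ x = u1 S1 + u2 S2} (mergeVal E1 E2 u1 u2 S) := by
  have hfin : {x : ℝ | ∃ S1 S2 : Finset α, S = S1 ∪ S2 ∧ Disjoint S1 S2 ∧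
      S1 ⊆ E1 ∧ S2 ⊆ E2 ∧ x = u1 S1 + u2 S2}.Finite := by
    refine ((S.powerset ×ˢ S.powerset).finite_toSet.image
      (fun p => u1 p.1 + u2 p.2)).subset ?_
    rintro x ⟨S1, S2, rfl, -, -, -, rfl⟩
    exact ⟨(S1, S2), by simp only [coe_product, Set.mem_prod, mem_coe, mem_powerset]; grind, rfl⟩
  refine ⟨Set.Nonempty.csSup_mem ?_ hfin, fun x hx => le_csSup hfin.bddAbove hx⟩
  exact ⟨_, S ∩ E1, S \ E1, by grind, by grind [disjoint_left], by grind, by grind, rfl⟩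

theorem GrossSubstitutes.merge {E1 E2 : Finset α} {u1 u2 : Finset α → ℝ}
    (h1 : GrossSubstitutes E1 u1) (h2 : GrossSubstitutes E2 u2) :
    GrossSubstitutes (E1 ∪ E2) (mergeVal E1 E2 u1 u2) := by
  obtain ⟨h, hgs, hX⟩ := exists_partialMerge h1 h2 (E1 ∩ E2) subset_rfl
  let c : α → α ⊕ α := fun x => if x ∈ E1 then Sum.inl x else Sum.inr x
  have hL : ∀ S : Finset α, (S.image c).toLeft = S ∩ E1 := fun S => by
    ext x; simp only [mem_toLeft, mem_image, c]; grind
  have hR : ∀ S : Finset α, (S.image c).toRight = S \ E1 := fun S => by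
    ext x; simp only [mem_toRight, mem_image, c]; grind
  have hE : (E1 ∪ E2).image c = E1.disjSum (E2 \ (E1 ∩ E2)) := by
    symm
    rw [disjSum_eq_iff, hL, hR]
    grind
  rw [← hE] at hgs
  refine (hgs.comp_image c).congr fun S hS => ?_
  obtain ⟨⟨S1, S2, hS12, hdis, hS1, hS2, he⟩, hub⟩ := mergeVal_isGreatest u1 u2 hS
  obtain ⟨⟨K, hK, hKe⟩, hle⟩ := hX (S.image c)
  rw [hL] at hK hle
  rw [hL, hR] at hKe
  rw [hR] at hle
  have hd := disjoint_left.1 hdis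
  apply le_antisymm
  · have := hle (S2 ∩ E1) (by grind)
    have e1 : (S ∩ E1) \ (S2 ∩ E1) = S1 := by grind
    have e2 : S \ E1 ∪ S2 ∩ E1 = S2 := by grind
    rw [e1, e2] at this
    rwa [he]
  · rw [hKe]
    exact hub ⟨_, _, by grind, by grind [disjoint_left], by grind, by grind, rfl⟩

theorem GrossSubstitutes.endow {E T : Finset α} {u : Finset α → ℝ} (hu : GrossSubstitutes E u)
    (hT : T ⊆ E) : GrossSubstitutes (E \ T) (fun S => u (S ∪ T) - u T) := by
  have hsub : ∀ {S : Finset α}, S ⊆ E \ T → S ∪ T ⊆ E := fun {S} hS =>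
    union_subset (hS.trans sdiff_subset) hT
  refine ⟨⟨by simp, fun S hS => sub_nonneg.2 (hu.1.2.2 subset_union_right (hsub hS)),
    fun S S' h hS' => sub_le_sub_right (hu.1.2.2 (union_subset_union_left h) (hsub hS')) _⟩, ?_⟩
  intro X Y hX hY i hi
  have hiT : i ∉ T := (mem_sdiff.1 (hX (mem_sdiff.1 hi).1)).2
  have e1 : (X ∪ T).erase i = X.erase i ∪ T := by grind
  have e2 : insert i (Y ∪ T) = insert i Y ∪ T := by grind
  rcases hu.2 (hsub hX) (hsub hY) i (by grind) with h | ⟨j, hj, h⟩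
  · left
    rw [e1, e2] at h
    linarith
  · have hjT : j ∉ T := by grind
    refine Or.inr ⟨j, by grind, ?_⟩
    have e3 : insert j (X.erase i ∪ T) = insert j (X.erase i) ∪ T := by grind
    have e4 : (insert i Y ∪ T).erase j = (insert i Y).erase j ∪ T := by grind
    rw [e1, e2, e3, e4] at h
    linarith

theorem FinMatroid.exchange (M : FinMatroid α) {I J : Finset α} (hI : M.Indep I) (hJ : M.Indep J)
    {i : α} (hi : i ∈ I \ J) :
    M.Indep (insert i J) ∨
      ∃ j ∈ J \ I, M.Indep (insert j (I.erase i)) ∧ M.Indep ((insert i J).erase j) := by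
  obtain ⟨hiI, hiJ⟩ := mem_sdiff.1 hi
  let N : Matroid α := (IndepMatroid.ofFinset (M.E : Set α) M.Indep M.indep_empty
    M.indep_subset M.indep_aug (fun I hI => by simpa using M.subset_ground hI)).matroid
  have hN : ∀ K : Finset α, N.Indep (K : Set α) ↔ M.Indep K := fun K => by
    simp only [N, IndepMatroid.matroid_Indep, IndepMatroid.ofFinset_indep]
  by_contra! hcon
  obtain ⟨h1, h2⟩ := hcon
  have hNI := (hN I).2 hI
  have hNJ := (hN J).2 hJ
  have hicl : i ∈ N.closure (J : Set α) := by
    by_contra h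
    rw [hNJ.notMem_closure_iff_of_notMem (by simpa using hiJ)
      (hNI.subset_ground (by simpa using hiI))] at h
    exact h1 ((hN _).1 (by simpa using h))
  have hC := hNJ.fundCircuit_isCircuit hicl (by simpa using hiJ)
  have hsub : N.fundCircuit i J \ {i} ⊆ N.closure ((I : Set α) \ {i}) := by
    rintro j ⟨hjC, hji⟩
    have hji : j ≠ i := by simpa using hji
    have hjJ : j ∈ J := by
      have := N.fundCircuit_subset_insert i J hjC
      simpa [hji] using this
    by_cases hjI : j ∈ I
    · exact N.subset_closure _ (Set.sdiff_subset.trans hNI.subset_ground) ⟨by simpa using hjI,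
        by simpa using hji⟩
    · rw [hNJ.mem_fundCircuit_iff hicl (by simpa using hiJ)] at hjC
      by_contra h
      rw [(hNI.subset Set.sdiff_subset).notMem_closure_iff_of_notMem (by simp [hjI])
        (hNJ.subset_ground (by simpa using hjJ))] at h
      exact h2 j (mem_sdiff.2 ⟨hjJ, hjI⟩) ((hN _).1 (by simpa using h))
        ((hN _).1 (by simpa using hjC))
  have hmem := hC.mem_closure_sdiff_singleton_of_mem (N.mem_fundCircuit i J)
  exact hNI.notMem_closure_sdiff_of_mem (by simpa using hiI)
    (N.closure_subset_closure_of_subset_closure hsub hmem)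

theorem weightedRank_isGreatest (M : FinMatroid α) (w : α → ℝ) (T : Finset α) :
    IsGreatest {x : ℝ | ∃ I : Finset α, M.Indep I ∧ I ⊆ T ∧ x = ∑ i ∈ I, w i}
      (weightedRank M w T) := by
  have hfin : {x : ℝ | ∃ I : Finset α, M.Indep I ∧ I ⊆ T ∧ x = ∑ i ∈ I, w i}.Finite := by
    refine (T.powerset.finite_toSet.image (fun I => ∑ i ∈ I, w i)).subset ?_
    rintro x ⟨I, -, hIT, rfl⟩
    exact ⟨I, by simpa using hIT, rfl⟩
  exact ⟨Set.Nonempty.csSup_mem ⟨_, ∅, M.indep_empty, by simp, rfl⟩ hfin,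
    fun x hx => le_csSup hfin.bddAbove hx⟩

theorem sum_le_weightedRank {M : FinMatroid α} (w : α → ℝ) {I T : Finset α} (hI : M.Indep I)
    (hIT : I ⊆ T) : ∑ i ∈ I, w i ≤ weightedRank M w T :=
  (weightedRank_isGreatest M w T).2 ⟨I, hI, hIT, rfl⟩

theorem grossSubstitutes_weightedRank (M : FinMatroid α) (w : α → ℝ) :
    GrossSubstitutes M.E (weightedRank M w) := by
  have hnonneg : ∀ S, 0 ≤ weightedRank M w S := fun S => by
    simpa using sum_le_weightedRank w M.indep_empty (empty_subset S)
  have hmono : ∀ {S T : Finset α}, S ⊆ T → weightedRank M w S ≤ weightedRank M w T := by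
    intro S T hST
    obtain ⟨I, hI, hIS, he⟩ := (weightedRank_isGreatest M w S).1
    rw [he]
    exact sum_le_weightedRank w hI (hIS.trans hST)
  refine ⟨⟨?_, fun S _ => hnonneg S, fun S T hST _ => hmono hST⟩, ?_⟩
  · obtain ⟨I, -, hI, he⟩ := (weightedRank_isGreatest M w ∅).1
    rw [he, subset_empty.1 hI, sum_empty]
  · intro S T hS hT i hi
    obtain ⟨hiS, hiT⟩ := mem_sdiff.1 hi
    obtain ⟨I, hI, hIS, heI⟩ := (weightedRank_isGreatest M w S).1
    obtain ⟨J, hJ, hJT, heJ⟩ := (weightedRank_isGreatest M w T).1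
    by_cases hiI : i ∈ I
    · have hiJ : i ∉ J := fun h => hiT (hJT h)
      have hsI := sum_erase_add I w hiI
      have hsJ := sum_insert (f := w) hiJ
      rcases M.exchange hI hJ (mem_sdiff.2 ⟨hiI, hiJ⟩) with h | ⟨j, hj, h1, h2⟩
      · left
        have := sum_le_weightedRank w (M.indep_subset hI (erase_subset i I))
          (erase_subset_erase i hIS)
        have := sum_le_weightedRank w h (insert_subset_insert i hJT)
        linarith
      · obtain ⟨hjJ, hjI⟩ := mem_sdiff.1 hj
        have hs1 := sum_insert (f := w) (show j ∉ I.erase i by grind)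
        have hs2 := sum_erase_add (insert i J) w (show j ∈ insert i J by grind)
        by_cases hjS : j ∈ S
        · left
          have := sum_le_weightedRank w h1 (show insert j (I.erase i) ⊆ S.erase i by grind)
          have := sum_le_weightedRank w h2 (show (insert i J).erase j ⊆ insert i T by grind)
          linarith
        · refine Or.inr ⟨j, by grind, ?_⟩
          have := sum_le_weightedRank w h1
            (show insert j (I.erase i) ⊆ insert j (S.erase i) by grind)
          have := sum_le_weightedRank w h2
            (show (insert i J).erase j ⊆ (insert i T).erase j by grind)
          linarith
    · left
      have := sum_le_weightedRank w hI (show I ⊆ S.erase i by grind)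
      have := hmono (subset_insert i T)
      linarith

/-- Concave functions of the cardinality are gross substitutes. -/
theorem grossSubstitutes_card (E : Finset α) (φ : ℕ → ℝ) (h0 : φ 0 = 0) (hmono : Monotone φ)
    (hconc : ∀ k l, l ≤ k → φ (k + 1) + φ l ≤ φ k + φ (l + 1)) :
    GrossSubstitutes E (fun S => φ S.card) := by
  refine ⟨⟨by simpa using h0, fun S _ => by simpa [h0] using hmono (Nat.zero_le S.card),
    fun S T hST _ => hmono (card_le_card hST)⟩, ?_⟩
  intro S T _ _ i hi
  obtain ⟨hiS, hiT⟩ := mem_sdiff.1 hi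
  have hc1 := card_erase_add_one hiS
  have hc2 := card_insert_of_notMem hiT
  by_cases hlt : T.card < S.card
  · left
    dsimp only
    rw [hc2, ← hc1]
    exact hconc _ _ (by omega)
  · have hne : (T \ S).Nonempty := by
      by_contra h
      have hTS : T ⊆ S := by simpa using h
      exact hlt (card_lt_card ⟨hTS, fun h => hiT (h hiS)⟩)
    obtain ⟨j, hj⟩ := hne
    refine Or.inr ⟨j, hj, ?_⟩
    obtain ⟨hjT, hjS⟩ := mem_sdiff.1 hj
    have hc3 := card_insert_of_notMem (show j ∉ S.erase i by grind)
    have hc4 := card_erase_add_one (show j ∈ insert i T by grind)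
    dsimp only
    rw [show (insert j (S.erase i)).card = S.card by omega,
      show ((insert i T).erase j).card = T.card by omega]

theorem grossSubstitutes_partitionVal {E : Finset α} (π : Finpartition E) {a b : ℝ}
    (ha : 0 < a) (hab : a < b) (hb : b < 2 * a) : GrossSubstitutes E (partitionVal π a b) := by
  let φ : ℕ → ℝ := fun k => if k = 0 then 0 else if k = 1 then a else b
  have hφ : GrossSubstitutes (E.image π.part) (fun S => φ S.card) := by
    refine grossSubstitutes_card _ φ (by simp [φ]) (monotone_nat_of_le_succ fun k => ?_) ?_
    · rcases k with _ | _ | k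
      · simp [φ, ha.le]
      · simp [φ, hab.le]
      · simp [φ]
    · intro k l hlk
      rcases k with _ | _ | k <;> rcases l with _ | _ | l <;> simp [φ] at hlk ⊢ <;> linarith
  refine (hφ.comp_image π.part).congr fun S hS => ?_
  unfold partitionVal
  rcases S.eq_empty_or_nonempty with rfl | hne
  · simp [φ]
  obtain ⟨x, hx⟩ := hne
  rw [if_neg (ne_empty_of_mem hx)]
  have hcard : (S.image π.part).card ≠ 0 := by simp [ne_empty_of_mem hx]
  simp only [φ, if_neg hcard]
  congr 1
  rw [eq_iff_iff, card_eq_one]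
  constructor
  · rintro ⟨p, hp, hSp⟩
    refine ⟨p, ?_⟩
    ext q
    simp only [mem_image, mem_singleton]
    constructor
    · rintro ⟨y, hy, rfl⟩
      exact π.part_eq_of_mem hp (hSp hy)
    · rintro rfl
      exact ⟨x, hx, π.part_eq_of_mem hp (hSp hx)⟩
  · rintro ⟨p, hp⟩
    refine ⟨π.part x, π.part_mem.2 (hS hx), fun y hy => ?_⟩
    have h1 : π.part x = p := by simpa [hp] using mem_image_of_mem π.part hx
    have h2 : π.part y = p := by simpa [hp] using mem_image_of_mem π.part hy
    rw [h1, ← h2]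
    exact π.mem_part_self.2 (hS hy)

theorem MBVP.grossSubstitutes {n : ℕ} {E : Finset (Fin n)} {u : Finset (Fin n) → ℝ}
    (h : MBVP n E u) : GrossSubstitutes E u := by
  induction h with
  | wrank M w _ => exact grossSubstitutes_weightedRank M w
  | part E π a b ha hab hb => exact grossSubstitutes_partitionVal π ha hab hb
  | merge _ _ h1 h2 => exact h1.merge h2
  | endow T hT _ h => exact h.endow hT

theorem GrossSubstitutes.eq_zero_of_singletons {E : Finset α} {u : Finset α → ℝ}
    (hu : GrossSubstitutes E u) (h0 : ∀ i ∈ E, u {i} = 0) {S : Finset α} (hS : S ⊆ E) :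
    u S = 0 := by
  induction S using Finset.induction_on with
  | empty => exact hu.1.1
  | insert i S hi ih =>
    have hSE := (subset_insert i S).trans hS
    refine le_antisymm ?_ (hu.1.2.1 _ hS)
    rcases hu.2 hS (empty_subset E) i (by simp) with h | ⟨j, hj, -⟩
    · simpa [hi, hu.1.1, ih hSE, h0 i (hS (mem_insert_self i S))] using h
    · simp at hj

theorem eq_left_of_merge {v : Finset α → ℝ} {a : ℝ} {E E1 E2 : Finset α}
    {u1 u2 : Finset α → ℝ} (h1 : GrossSubstitutes E1 u1) (h2 : GrossSubstitutes E2 u2)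
    (hE : E1 ∪ E2 = E) (hsing : ∀ i ∈ E, v {i} = a) (hlt : ∀ S ⊆ E, v S < 2 * a)
    (hpair : ∀ i ∈ E, ∃ j ∈ E, j ≠ i ∧ v {i, j} = a)
    (hle : ∀ S1 ⊆ E1, ∀ S2 ⊆ E2, Disjoint S1 S2 → u1 S1 + u2 S2 ≤ v (S1 ∪ S2))
    (hex : ∀ S ⊆ E, ∃ S1 ⊆ E1, ∃ S2 ⊆ E2, S1 ∪ S2 = S ∧ Disjoint S1 S2 ∧ v S = u1 S1 + u2 S2)
    {x : α} (hx : x ∈ E1) (hxa : u1 {x} = a) :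
    E1 = E ∧ ∀ S ⊆ E, v S = u1 S := by
  have hE1 : E1 ⊆ E := hE ▸ subset_union_left
  have hE2 : E2 ⊆ E := hE ▸ subset_union_right
  have hall : ∀ i ∈ E, i ∈ E1 ∧ u1 {i} = a := by
    intro i hi
    by_cases hix : i = x
    · exact hix ▸ ⟨hx, hxa⟩
    obtain ⟨S1, hS1, S2, hS2, hS, hd, hv⟩ := hex {i} (by simpa using hi)
    rw [hsing i hi] at hv
    rcases subset_singleton_iff.1 (hS ▸ subset_union_right : S2 ⊆ {i}) with rfl | rfl
    · rw [union_empty] at hS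
      subst hS
      exact ⟨hS1 (mem_singleton_self i), by rw [hv, h2.1.1, add_zero]⟩
    · rcases subset_singleton_iff.1 (hS ▸ subset_union_left : S1 ⊆ {i}) with rfl | rfl
      · have h3 := hle {x} (by simpa using hx) {i} hS2 (by simpa using Ne.symm hix)
        have h4 := hlt ({x} ∪ {i}) (by grind)
        rw [h1.1.1] at hv
        linarith
      · simp at hd
  have hE1E : E1 = E := subset_antisymm hE1 fun i hi => (hall i hi).1
  have hzero : ∀ i ∈ E2, u2 {i} = 0 := by
    intro i hi
    obtain ⟨j, hj, hji, hv⟩ := hpair i (hE2 hi)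
    have h3 := hle {j} (by simpa using (hall j hj).1) {i} (by simpa using hi) (by simpa using hji)
    rw [(hall j hj).2, union_comm, ← insert_eq, hv] at h3
    exact le_antisymm (by linarith) (h2.1.2.1 _ (by simpa using hi))
  refine ⟨hE1E, fun S hS => ?_⟩
  apply le_antisymm
  · obtain ⟨S1, -, S2, hS2, rfl, -, hv⟩ := hex S hS
    rw [hv, h2.eq_zero_of_singletons hzero hS2, add_zero]
    exact h1.1.2.2 subset_union_left (hE1E ▸ hS)
  · have := hle S (hE1E ▸ hS) ∅ (empty_subset _) (disjoint_empty_right _)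
    rwa [h2.1.1, add_zero, union_empty] at this

/-- If all singletons have the same value `a`, all values are less than `2 * a`, and every element
has a parallel element, then any merge decomposition is trivial. -/
theorem eq_of_eq_mergeVal {v : Finset α → ℝ} {a : ℝ} {E E1 E2 : Finset α}
    {u1 u2 : Finset α → ℝ} (h1 : GrossSubstitutes E1 u1) (h2 : GrossSubstitutes E2 u2)
    (hE : E1 ∪ E2 = E) (hne : E.Nonempty) (hsing : ∀ i ∈ E, v {i} = a)
    (hlt : ∀ S ⊆ E, v S < 2 * a) (hpair : ∀ i ∈ E, ∃ j ∈ E, j ≠ i ∧ v {i, j} = a)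
    (hmerge : ∀ S ⊆ E, v S = mergeVal E1 E2 u1 u2 S) :
    (E1 = E ∧ ∀ S ⊆ E, v S = u1 S) ∨ (E2 = E ∧ ∀ S ⊆ E, v S = u2 S) := by
  have hle : ∀ S1 ⊆ E1, ∀ S2 ⊆ E2, Disjoint S1 S2 → u1 S1 + u2 S2 ≤ v (S1 ∪ S2) := by
    intro S1 hS1 S2 hS2 hd
    have hS : S1 ∪ S2 ⊆ E1 ∪ E2 := union_subset_union hS1 hS2
    rw [hmerge _ (hE ▸ hS)]
    exact (mergeVal_isGreatest u1 u2 hS).2 ⟨S1, S2, rfl, hd, hS1, hS2, rfl⟩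
  have hex : ∀ S ⊆ E, ∃ S1 ⊆ E1, ∃ S2 ⊆ E2, S1 ∪ S2 = S ∧ Disjoint S1 S2 ∧
      v S = u1 S1 + u2 S2 := by
    intro S hS
    obtain ⟨S1, S2, he, hd, hS1, hS2, hv⟩ := (mergeVal_isGreatest u1 u2 (hE.symm ▸ hS)).1
    exact ⟨S1, hS1, S2, hS2, he.symm, hd, (hmerge S hS).trans hv⟩
  obtain ⟨x, hx⟩ := hne
  obtain ⟨S1, hS1, S2, hS2, hS, hd, hv⟩ := hex {x} (by simpa using hx)
  rw [hsing x hx] at hv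
  rcases subset_singleton_iff.1 (hS ▸ subset_union_right : S2 ⊆ {x}) with rfl | rfl
  · rw [union_empty] at hS
    subst hS
    exact Or.inl (eq_left_of_merge h1 h2 hE hsing hlt hpair hle hex (hS1 (mem_singleton_self x))
      (by rw [hv, h2.1.1, add_zero]))
  · have hS1e : S1 = ∅ := by
      rcases subset_singleton_iff.1 (hS ▸ subset_union_left : S1 ⊆ {x}) with h | rfl
      · exact h
      · simp at hd
    subst hS1e
    refine Or.inr (eq_left_of_merge h2 h1 (by rw [union_comm, hE]) hsing hlt hpair ?_ ?_
      (hS2 (mem_singleton_self x)) (by rw [hv, h1.1.1, zero_add]))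
    · intro S2 hS2 S1 hS1 hd
      rw [add_comm, union_comm]
      exact hle S1 hS1 S2 hS2 hd.symm
    · intro S hS
      obtain ⟨S1, hS1, S2, hS2, he, hd, hv⟩ := hex S hS
      exact ⟨S2, hS2, S1, hS1, by rw [union_comm, he], hd.symm, by rw [hv, add_comm]⟩

/-- An ultrametric-type valuation on three elements, where `2` is far from `0` and `1`. -/
def treeVal (A : Finset (Fin 3)) : ℕ :=
  if A = ∅ then 0 else if A.card = 1 then 4 else if 2 ∈ A then 6 else 5

theorem treeVal_mono : ∀ A B : Finset (Fin 3), A ⊆ B → treeVal A ≤ treeVal B := by decide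

theorem treeVal_lt : ∀ A : Finset (Fin 3), treeVal A < 8 := by decide

theorem treeVal_exchange : ∀ A B : Finset (Fin 3), ∀ i ∈ A \ B,
    treeVal A + treeVal B ≤ treeVal (A.erase i) + treeVal (insert i B) ∨
      ∃ j ∈ B \ A, treeVal A + treeVal B ≤
        treeVal (insert j (A.erase i)) + treeVal ((insert i B).erase j) := by decide

theorem grossSubstitutes_treeVal (E : Finset (Fin 3)) :
    GrossSubstitutes E (fun A => (treeVal A : ℝ)) := by
  refine ⟨⟨by simp [treeVal], fun S _ => by positivity, fun S T h _ => ?_⟩, fun S T _ _ i hi => ?_⟩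
  · dsimp only
    exact_mod_cast treeVal_mono S T h
  · dsimp only
    exact_mod_cast treeVal_exchange S T i hi

/-- The partition of `Fin n` into `{0, 1}`, `{2, 3}` and the rest. -/
def treeClass {n : ℕ} (i : Fin n) : Fin 3 :=
  if i.val < 2 then 0 else if i.val < 4 then 1 else 2

theorem exists_ne_treeClass_eq {n : ℕ} (hn : 6 ≤ n) (i : Fin n) :
    ∃ j, j ≠ i ∧ treeClass j = treeClass i := by
  by_cases h0 : i.val = 0
  · exact ⟨⟨1, by omega⟩, by simp [Fin.ext_iff, h0], by simp [treeClass, h0]⟩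
  by_cases h1 : i.val = 1
  · exact ⟨⟨0, by omega⟩, by simp [Fin.ext_iff, h1], by simp [treeClass, h1]⟩
  by_cases h2 : i.val = 2
  · exact ⟨⟨3, by omega⟩, by simp [Fin.ext_iff, h2], by simp [treeClass, h2]⟩
  by_cases h3 : i.val = 3
  · exact ⟨⟨2, by omega⟩, by simp [Fin.ext_iff, h3], by simp [treeClass, h3]⟩
  have hi : ¬ i.val < 2 ∧ ¬ i.val < 4 := by omega
  by_cases h4 : i.val = 4
  · exact ⟨⟨5, by omega⟩, by simp [Fin.ext_iff, h4], by simp [treeClass, h4]⟩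
  · exact ⟨⟨4, by omega⟩, by simp [Fin.ext_iff]; omega, by simp [treeClass, hi]⟩

theorem exists_weightedRank_eq_mul {M : FinMatroid α} {w : α → ℝ} {a : ℝ}
    (hw : ∀ i, weightedRank M w {i} = a) (ha : a ≠ 0) (T : Finset α) :
    ∃ k : ℕ, weightedRank M w T = k * a := by
  have hwi : ∀ i, w i = a := by
    intro i
    obtain ⟨I, -, hI, he⟩ := (weightedRank_isGreatest M w {i}).1
    rw [hw i] at he
    rcases subset_singleton_iff.1 hI with rfl | rfl
    · exact absurd (by simpa using he) ha
    · simpa using he.symm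
  obtain ⟨I, -, -, he⟩ := (weightedRank_isGreatest M w T).1
  exact ⟨I.card, by rw [he]; simp [hwi]⟩

theorem partitionVal_eq_or {E : Finset α} (π : Finpartition E) (a b : ℝ) {S : Finset α}
    (hS : S ≠ ∅) : partitionVal π a b S = a ∨ partitionVal π a b S = b := by
  unfold partitionVal
  rw [if_neg hS]
  split_ifs <;> simp

theorem treeVal_singleton {n : ℕ} (i : Fin n) :
    treeVal (({i} : Finset (Fin n)).image treeClass) = 4 := by
  simp [treeVal]

theorem treeVal_eq_of_mergeVal {n : ℕ} (hn : 6 ≤ n) {E1 E2 : Finset (Fin n)}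
    {u1 u2 : Finset (Fin n) → ℝ} (h1 : GrossSubstitutes E1 u1) (h2 : GrossSubstitutes E2 u2)
    (hE : E1 ∪ E2 = univ)
    (hmerge : (fun S => (treeVal (S.image treeClass) : ℝ)) = mergeVal E1 E2 u1 u2) :
    (E1 = univ ∧ (fun S => (treeVal (S.image treeClass) : ℝ)) = u1) ∨
      (E2 = univ ∧ (fun S => (treeVal (S.image treeClass) : ℝ)) = u2) := by
  have key := eq_of_eq_mergeVal (v := fun S => (treeVal (S.image treeClass) : ℝ)) (a := 4)
    h1 h2 hE ⟨⟨0, by omega⟩, mem_univ _⟩ (fun i _ => ?_) (fun S _ => ?_) (fun i _ => ?_)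
    (fun S _ => congrFun hmerge S)
  · simpa [funext_iff] using key
  · rw [treeVal_singleton]; norm_num
  · have := treeVal_lt (S.image treeClass)
    norm_num
    exact_mod_cast this
  · obtain ⟨j, hji, hj⟩ := exists_ne_treeClass_eq hn i
    refine ⟨j, mem_univ j, hji, ?_⟩
    rw [image_insert, image_singleton, hj]
    norm_num [treeVal]

theorem treeVal_not_mbvp {n : ℕ} (hn : 6 ≤ n) {E : Finset (Fin n)} {u : Finset (Fin n) → ℝ}
    (h : MBVP n E u) (hE : E = univ)
    (hu : (fun S => (treeVal (S.image treeClass) : ℝ)) = u) : False := by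
  let x0 : Fin n := ⟨0, by omega⟩
  let x2 : Fin n := ⟨2, by omega⟩
  let x4 : Fin n := ⟨4, by omega⟩
  have hx0 : treeClass x0 = 0 := by simp [treeClass, x0]
  have hx2 : treeClass x2 = 1 := by simp [treeClass, x2]
  have hx4 : treeClass x4 = 2 := by simp [treeClass, x4]
  have hv5 : treeVal (({x0, x2} : Finset (Fin n)).image treeClass) = 5 := by
    rw [image_insert, image_singleton, hx0, hx2]; decide
  have hv6 : treeVal (({x0, x4} : Finset (Fin n)).image treeClass) = 6 := by
    rw [image_insert, image_singleton, hx0, hx4]; decide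
  induction h with
  | wrank M w _ =>
    obtain ⟨k, hk⟩ := exists_weightedRank_eq_mul (M := M) (w := w) (a := 4)
      (fun i => by rw [← congrFun hu, treeVal_singleton]; norm_num) (by norm_num) {x0, x2}
    rw [← congrFun hu, hv5] at hk
    have : 5 = k * 4 := by exact_mod_cast hk
    omega
  | part E π a b ha hab hb =>
    have h4 := partitionVal_eq_or π a b (singleton_ne_empty x0)
    have h5 := partitionVal_eq_or π a b (insert_ne_empty x0 {x2})
    have h6 := partitionVal_eq_or π a b (insert_ne_empty x0 {x4})
    rw [← congrFun hu, treeVal_singleton] at h4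
    rw [← congrFun hu, hv5] at h5
    rw [← congrFun hu, hv6] at h6
    push_cast at h4 h5 h6
    rcases h4 with h4 | h4 <;> rcases h5 with h5 | h5 <;> rcases h6 with h6 | h6 <;> linarith
  | merge h1 h2 ih1 ih2 =>
    rcases treeVal_eq_of_mergeVal hn h1.grossSubstitutes h2.grossSubstitutes hE hu with h | h
    · exact ih1 h.1 h.2
    · exact ih2 h.1 h.2
  | @endow E u T hT h ih =>
    have hT0 : T = ∅ := by
      rw [eq_empty_iff_forall_notMem]
      intro x hx
      have : x ∈ E \ T := hE ▸ mem_univ x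
      exact (mem_sdiff.1 this).2 hx
    subst hT0
    refine ih (by simpa using hE) ?_
    rw [hu]
    simp [h.grossSubstitutes.1.1]

/-- For every `n ≥ 6` there is an irreducible gross substitutes valuation on
`[n]` outside the class generated by weighted matroid ranks and partition
valuations under merging and endowment. -/
theorem exists_irreducible_not_mbvp (n : ℕ) (hn : 6 ≤ n) :
    ∃ v : Finset (Fin n) → ℝ,
      GrossSubstitutes (Finset.univ : Finset (Fin n)) v ∧
      IrreducibleVal v ∧ ¬ MBVP n Finset.univ v := by
  refine ⟨fun S => (treeVal (S.image treeClass) : ℝ),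
    (grossSubstitutes_treeVal _).comp_image treeClass, ?_, fun h => treeVal_not_mbvp hn h rfl rfl⟩
  intro E1 E2 u1 u2 h1 h2 hE hmerge
  exact (treeVal_eq_of_mergeVal hn h1 h2 hE hmerge).imp And.right And.right
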